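/- Let g : 𝒳 → 𝒵 and h : 𝒵 → 𝒴 be measurable, Ŷ = h(g(X)), Z = g(X), and let w_M := max_{y∈𝒴} w_y. Then for every y ∈ 𝒴 and every measurable set E ⊆ 𝒵: |Σ_{y'∈𝒴} w_{y'}·D_S(Z ∈ E, Ŷ = y, Y = y') − w_y·D_S(Z ∈ E, Y = y)| ≤ w_M · ε_S(Ŷ), where ε_S(Ŷ) = D_S(Ŷ ≠ Y) and the left-hand side first term is the w-reweighted source probability D_S^w(Z ∈ E, Ŷ = y). -/

import Mathlib

open MeasureTheory Real
open scoped ENNReal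

/-- Importance weights `w_y = D_T(Y = y) / D_S(Y = y)`. -/
noncomputable def iw {𝒳 : Type*} [MeasurableSpace 𝒳] {k : ℕ}
    (DS DT : Measure (𝒳 × Fin k)) (y : Fin k) : ℝ :=
  (DT {p | p.2 = y}).toReal / (DS {p | p.2 = y}).toReal

theorem iw_nonneg {𝒳 : Type*} [MeasurableSpace 𝒳] {k : ℕ}
    (DS DT : Measure (𝒳 × Fin k)) (y : Fin k) : 0 ≤ iw DS DT y :=
  div_nonneg ENNReal.toReal_nonneg ENNReal.toReal_nonneg

/-- The `w`-reweighted source probability of `{Z ∈ E, Ŷ = y}` differs from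
`w_y·D_S(Z ∈ E, Y = y)` by at most `w_M·ε_S(Ŷ)`. -/
theorem reweighted_joint_gap_le_err
    {𝒳 Z : Type*} [MeasurableSpace 𝒳] [MeasurableSpace Z] {k : ℕ} (hk : 2 ≤ k)
    (DS DT : Measure (𝒳 × Fin k)) [IsProbabilityMeasure DS] [IsProbabilityMeasure DT]
    (hS : ∀ y : Fin k, 0 < DS {p | p.2 = y})
    (g : 𝒳 → Z) (hg : Measurable g) (h : Z → Fin k) (hh : Measurable h)
    (y : Fin k) (E : Set Z) (hE : MeasurableSet E) :
    |(∑ y' : Fin k, iw DS DT y' *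
          (DS ({p | g p.1 ∈ E} ∩ {p | h (g p.1) = y} ∩ {p | p.2 = y'})).toReal) -
        iw DS DT y * (DS ({p | g p.1 ∈ E} ∩ {p | p.2 = y})).toReal| ≤
      (⨆ y' : Fin k, iw DS DT y') * (DS {p | h (g p.1) ≠ p.2}).toReal := by
  have hw : ∀ y', iw DS DT y' ≤ ⨆ y', iw DS DT y' :=
    le_ciSup (Set.finite_range _).bddAbove
  have hM : 0 ≤ ⨆ y', iw DS DT y' := (iw_nonneg DS DT y).trans (hw y)
  have hY : ∀ y' : Fin k, MeasurableSet {p : 𝒳 × Fin k | p.2 = y'} := fun y' =>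
    measurable_snd (measurableSet_singleton y')
  have hEm : MeasurableSet {p : 𝒳 × Fin k | g p.1 ∈ E} := (hg.comp measurable_fst) hE
  have hP : MeasurableSet {p : 𝒳 × Fin k | h (g p.1) = y} :=
    (hh.comp (hg.comp measurable_fst)) (measurableSet_singleton y)
  simp only [← measureReal_def]
  set A : Set (𝒳 × Fin k) := {p | g p.1 ∈ E}
  set P : Set (𝒳 × Fin k) := {p | h (g p.1) = y}
  set err : Set (𝒳 × Fin k) := {p | h (g p.1) ≠ p.2}
  -- Mass wrongly predicted as `y`.
  have hfalse : ∑ y' ∈ Finset.univ.erase y, iw DS DT y' * DS.real (A ∩ P ∩ {p | p.2 = y'}) ≤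
      (⨆ y', iw DS DT y') * DS.real err := by
    calc _ ≤ ∑ y' ∈ Finset.univ.erase y,
          (⨆ y', iw DS DT y') * DS.real (A ∩ P ∩ {p | p.2 = y'}) :=
          Finset.sum_le_sum fun y' _ => mul_le_mul_of_nonneg_right (hw y') measureReal_nonneg
      _ = (⨆ y', iw DS DT y') *
          DS.real (⋃ y' ∈ Finset.univ.erase y, A ∩ P ∩ {p | p.2 = y'}) := by
          rw [← Finset.mul_sum, measureReal_biUnion_finset]
          · intro a _ b _ hab
            refine Set.disjoint_left.2 fun p ha hb => hab ?_
            exact ha.2.symm.trans hb.2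
          · exact fun y' _ => (hEm.inter hP).inter (hY y')
      _ ≤ _ := by
          refine mul_le_mul_of_nonneg_left (measureReal_mono ?_) hM
          refine Set.iUnion₂_subset fun y' hy' p hp he => Finset.ne_of_mem_erase hy' ?_
          exact hp.2.symm.trans (he.symm.trans hp.1.2)
  have hfalse0 :
      0 ≤ ∑ y' ∈ Finset.univ.erase y, iw DS DT y' * DS.real (A ∩ P ∩ {p | p.2 = y'}) :=
    Finset.sum_nonneg fun y' _ => mul_nonneg (iw_nonneg DS DT y') measureReal_nonneg
  -- Mass of label `y` predicted as another label.
  have hmiss : iw DS DT y * DS.real ((A ∩ {p | p.2 = y}) \ P) ≤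
      (⨆ y', iw DS DT y') * DS.real err := by
    refine mul_le_mul (hw y) (measureReal_mono ?_) measureReal_nonneg hM
    exact fun p hp he => hp.2 (he.trans hp.1.2)
  have hmiss0 : 0 ≤ iw DS DT y * DS.real ((A ∩ {p | p.2 = y}) \ P) :=
    mul_nonneg (iw_nonneg DS DT y) measureReal_nonneg
  rw [← Finset.add_sum_erase _ _ (Finset.mem_univ y),
    ← measureReal_inter_add_sdiff (μ := DS) (s := A ∩ {p | p.2 = y}) hP,
    Set.inter_right_comm A {p | p.2 = y} P, mul_add, abs_le]
  constructor <;> linarith
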